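/- arXiv:math/0405092 — 2 statements merged into one kernel-verified Lean document; each statement's English description precedes it below -/
import Mathlib

section
/- For every j ∈ ℕ and every μ > 0 there is a finite collection 𝒳 of finite subsets of Q, with each member a of 𝒳 satisfying Σ_{t∈a} 2^{−|t|} ≤ μ, such that ν(𝒳) ≥ j. -/
open MeasureTheory Filter Set Topology
open scoped ENNReal

noncomputable section

/-- The Cantor space `2^ℕ`. -/
abbrev Cantor : Type := ℕ → Bool

/-- The uniform product ("fair coin-flipping") probability measure on `2^ℕ`, realized as the
pushforward of Lebesgue measure on `[0,1)` under the binary-digit map. -/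
noncomputable def cantorMeasure : Measure Cantor :=
  Measure.map (fun x : ℝ => fun n : ℕ => decide (⌊x * 2 ^ (n + 1)⌋ % 2 = 1))
    (volume.restrict (Set.Ico (0 : ℝ) 1))

/-- The basic cylinder `[a]` determined by a finite binary sequence `a`. -/
def cyl (a : List Bool) : Set Cantor := {x | ∀ i : Fin a.length, x i = a.get i}

/-- `[A] = ⋃ a ∈ A, [a]`. -/
def cylSet (A : Set (List Bool)) : Set Cantor := ⋃ a ∈ A, cyl a

/-- The weight `2^(-|a|·r)` of a node `a`. -/
noncomputable def wt (r : ℝ) (a : List Bool) : ℝ≥0∞ := (2 : ℝ≥0∞) ^ (-(a.length : ℝ) * r)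

/-- `Σ_{a ∈ A} 2^(-|a|·r)`. -/
noncomputable def wtSum (r : ℝ) (A : Set (List Bool)) : ℝ≥0∞ := ∑' a : A, wt r (a : List Bool)

/-- `A ∈ C^∞_ε`, i.e. `Σ_{a ∈ A} 2^(-|a|·r) ≤ ε`. -/
def memCinf (r ε : ℝ) (A : Set (List Bool)) : Prop := wtSum r A ≤ ENNReal.ofReal ε

/-- The `r`-dimensional dyadic Hausdorff capacity `λ^r_∞`. -/
noncomputable def hcap (r : ℝ) (X : Set Cantor) : ℝ≥0∞ :=
  ⨅ (A : Set (List Bool)) (_ : X ⊆ cylSet A), wtSum r A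

/-- `□_δ(X) = inf {λ^r_∞(X \ Z) : Z measurable, λ Z < δ}`. -/
noncomputable def sqcap (r δ : ℝ) (X : Set Cantor) : ℝ≥0∞ :=
  ⨅ (Z : Set Cantor) (_ : MeasurableSet Z) (_ : cantorMeasure Z < ENNReal.ofReal δ),
    hcap r (X \ Z)

/-- The relation `□_{Θ,Γ}(X)` for `X ⊆ (2^ℕ)^(d+1)` (the index `d` codes dimension `d+1`):
for dimension `1` it says `□_{Θ 0}(X) ≥ Γ 0`, and for dimension `n+2` it says
`□_{Θ (n+1)}({x : □_{Θ,Γ}(X(x,·))}) ≥ Γ (n+1)`, slicing along the first coordinate. -/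
def SqTG (r : ℝ) (Θ Γ : ℕ → ℝ) : (d : ℕ) → Set (Fin (d + 1) → Cantor) → Prop
  | 0, X => ENNReal.ofReal (Γ 0) ≤ sqcap r (Θ 0) {y : Cantor | (fun _ : Fin 1 => y) ∈ X}
  | (n + 1), X => ENNReal.ofReal (Γ (n + 1)) ≤
      sqcap r (Θ (n + 1))
        {x : Cantor | SqTG r Θ Γ n {y : Fin (n + 1) → Cantor | Fin.cons x y ∈ X}}

/-- `□_{Θ,Γ}` reindexed by the true dimension `d ≥ 1`. -/
def SqDim (r : ℝ) (Θ Γ : ℕ → ℝ) : (d : ℕ) → Set (Fin d → Cantor) → Prop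
  | 0, _ => False
  | (n + 1), X => SqTG r Θ Γ n X

/-- `□_*(X)` : `□_{η,Γ}(X)` holds for some `η : ℕ → ℝ⁺`. -/
def SqStarDim (r : ℝ) (Γ : ℕ → ℝ) (d : ℕ) (X : Set (Fin d → Cantor)) : Prop :=
  ∃ η : ℕ → ℝ, (∀ i, 0 < η i) ∧ SqDim r η Γ d X

/-- `⟨z,F⟩ = {w ∈ 𝒳 : z ∉ [F w]}`. -/
def angbr (z : Cantor) (F : Set (List Bool) → Set (List Bool))
    (𝒳 : Set (Set (List Bool))) : Set (Set (List Bool)) := {w ∈ 𝒳 | z ∉ cylSet (F w)}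

/-- `ρ*(𝒳)`: the set of `d > 1` such that for every compact `C ⊆ (2^ℕ)^d` with `□(C)` and every
continuous `F : C → 2^ℕ` there is `x ∈ 𝒳` with `□_*(F⁻¹[x])`. -/
def rhoStar (r : ℝ) (Θ Γ : ℕ → ℝ) (𝒳 : Set (Set (List Bool))) : Set ℕ :=
  {d : ℕ | 1 < d ∧ ∀ C : Set (Fin d → Cantor), IsCompact C → SqDim r Θ Γ d C →
    ∀ F : (Fin d → Cantor) → Cantor, ContinuousOn F C →
      ∃ x ∈ 𝒳, SqStarDim r Γ d (C ∩ F ⁻¹' cylSet x)}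

/-- `ρ(𝒳) = sup ρ*(𝒳)` (with `sup ∅ = 0`). -/
noncomputable def rho (r : ℝ) (Θ Γ : ℕ → ℝ) (𝒳 : Set (Set (List Bool))) : ℕ∞ :=
  sSup ((fun d : ℕ => (d : ℕ∞)) '' rhoStar r Θ Γ 𝒳)

/-- The sets `𝒩_j` (with finite-set-valued test functions `F`). -/
def Nrec (r : ℝ) (Θ Γ : ℕ → ℝ) : ℕ → Set (Set (Set (List Bool)))
  | 0 => {𝒳 | 𝒳.Nonempty}
  | 1 => {𝒳 | cylSet (⋃₀ 𝒳) = Set.univ}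
  | (k + 2) => {𝒳 | ∀ F : Set (List Bool) → Set (List Bool),
      (∀ a ∈ 𝒳, (F a).Finite ∧ memCinf r (Γ (k + 1) / 2) (F a)) →
      sqcap r (Θ k) {z : Cantor | angbr z F 𝒳 ∉ Nrec r Θ Γ (k + 1)} <
        ENNReal.ofReal (Γ (k + 1))}

/-- The sets `𝒩^∞_j` (with `C^∞`-valued test functions `F`). -/
def NrecInf (r : ℝ) (Θ Γ : ℕ → ℝ) : ℕ → Set (Set (Set (List Bool)))
  | 0 => {𝒳 | 𝒳.Nonempty}
  | 1 => {𝒳 | cylSet (⋃₀ 𝒳) = Set.univ}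
  | (k + 2) => {𝒳 | ∀ F : Set (List Bool) → Set (List Bool),
      (∀ a ∈ 𝒳, memCinf r (Γ (k + 1) / 2) (F a)) →
      sqcap r (Θ k) {z : Cantor | angbr z F 𝒳 ∉ NrecInf r Θ Γ (k + 1)} <
        ENNReal.ofReal (Γ (k + 1))}

/-- `ν(𝒳) = sup {j : 𝒳 ∈ 𝒩_j}`. -/
noncomputable def nu (r : ℝ) (Θ Γ : ℕ → ℝ) (𝒳 : Set (Set (List Bool))) : ℕ∞ :=
  sSup ((fun j : ℕ => (j : ℕ∞)) '' {j | 𝒳 ∈ Nrec r Θ Γ j})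

/-- `ν^∞(𝒳) = sup {j : 𝒳 ∈ 𝒩^∞_j}`. -/
noncomputable def nuInf (r : ℝ) (Θ Γ : ℕ → ℝ) (𝒳 : Set (Set (List Bool))) : ℕ∞ :=
  sSup ((fun j : ℕ => (j : ℕ∞)) '' {j | 𝒳 ∈ NrecInf r Θ Γ j})

/-- Expectation of `f` at a random subset of `ι` containing each point independently with
probability `q`. -/
def bernExp {ι : Type} [Fintype ι] (q : ℝ) (f : Finset ι → ℝ) : ℝ :=
  ∑ a : Finset ι, q ^ a.card * (1 - q) ^ (Fintype.card ι - a.card) * f a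

theorem bernExp_const {ι : Type} [Fintype ι] (q c : ℝ) :
    bernExp q (fun _ : Finset ι => c) = c := by
  unfold bernExp
  rw [← Finset.sum_mul, Fintype.sum_pow_mul_eq_add_pow]
  simp

theorem bernExp_add {ι : Type} [Fintype ι] (q : ℝ) (f g : Finset ι → ℝ) :
    bernExp q (fun a => f a + g a) = bernExp q f + bernExp q g := by
  simp only [bernExp, mul_add, Finset.sum_add_distrib]

theorem bernExp_sub {ι : Type} [Fintype ι] (q : ℝ) (f g : Finset ι → ℝ) :
    bernExp q (fun a => f a - g a) = bernExp q f - bernExp q g := by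
  simp only [bernExp, mul_sub, Finset.sum_sub_distrib]

theorem bernExp_const_mul {ι : Type} [Fintype ι] (q c : ℝ) (f : Finset ι → ℝ) :
    bernExp q (fun a => c * f a) = c * bernExp q f := by
  simp only [bernExp, Finset.mul_sum]
  exact Finset.sum_congr rfl fun a _ => by ring

theorem bernExp_sum {ι α : Type} [Fintype ι] (q : ℝ) (s : Finset α) (f : α → Finset ι → ℝ) :
    bernExp q (fun a => ∑ i ∈ s, f i a) = ∑ i ∈ s, bernExp q (f i) := by
  simp only [bernExp, Finset.mul_sum]
  exact Finset.sum_comm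

theorem bernExp_mono {ι : Type} [Fintype ι] {q : ℝ} (hq : 0 ≤ q) (hq' : q ≤ 1)
    {f g : Finset ι → ℝ} (h : ∀ a, f a ≤ g a) : bernExp q f ≤ bernExp q g :=
  Finset.sum_le_sum fun a _ => mul_le_mul_of_nonneg_left (h a)
    (mul_nonneg (pow_nonneg hq _) (pow_nonneg (sub_nonneg.2 hq') _))

theorem bernExp_insert {ι : Type} [Fintype ι] [DecidableEq ι] (q : ℝ) (x : ι)
    (f : Finset ι → ℝ) :
    bernExp q (fun a => if x ∈ a then f a else 0) = q * bernExp q (fun a => f (insert x a)) := by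
  have key : ∀ g : Finset ι → ℝ, bernExp q g =
      ∑ a ∈ (Finset.univ.erase x).powerset, q ^ a.card *
        (1 - q) ^ (Fintype.card ι - (a.card + 1)) * ((1 - q) * g a + q * g (insert x a)) := by
    intro g
    unfold bernExp
    rw [← Finset.powerset_univ]
    nth_rewrite 1 [← Finset.insert_erase (Finset.mem_univ x)]
    rw [Finset.sum_powerset_insert (Finset.notMem_erase _ _), ← Finset.sum_add_distrib]
    refine Finset.sum_congr rfl fun a ha => ?_
    have hsub := Finset.mem_powerset.1 ha
    have hx : x ∉ a := fun h => Finset.notMem_erase x _ (hsub h)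
    have hc : a.card + 1 ≤ Fintype.card ι := by
      rw [← Finset.card_insert_of_notMem hx]; exact Finset.card_le_univ _
    rw [Finset.card_insert_of_notMem hx,
      show Fintype.card ι - a.card = Fintype.card ι - (a.card + 1) + 1 by omega, pow_succ, pow_succ]
    ring
  rw [key, key, Finset.mul_sum]
  refine Finset.sum_congr rfl fun a ha => ?_
  have hx : x ∉ a := fun h => Finset.notMem_erase x _ (Finset.mem_powerset.1 ha h)
  simp only [hx, Finset.mem_insert_self, Finset.insert_idem, if_true, if_false]
  ring

theorem bernExp_subset {ι : Type} [Fintype ι] [DecidableEq ι] (q : ℝ) (J : Finset ι)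
    (f : Finset ι → ℝ) :
    bernExp q (fun a => if J ⊆ a then f a else 0) =
      q ^ J.card * bernExp q (fun a => f (a ∪ J)) := by
  induction J using Finset.induction_on generalizing f with
  | empty => simp
  | insert x J hx ih =>
    have h1 : (fun a : Finset ι => if insert x J ⊆ a then f a else 0) =
        fun a => if x ∈ a then (if J ⊆ a then f a else 0) else 0 := by
      funext a
      by_cases h : x ∈ a <;> simp [Finset.insert_subset_iff, h]
    have h2 : (fun a : Finset ι => if J ⊆ insert x a then f (insert x a) else 0) =
        fun a => if J ⊆ a then f (insert x a) else 0 := by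
      funext a
      simp only [Finset.subset_insert_iff_of_notMem hx]
    rw [h1, bernExp_insert, h2, ih (fun a => f (insert x a)), Finset.card_insert_of_notMem hx,
      pow_succ]
    simp only [Finset.union_insert]
    ring

/-- The likelihood ratio of conditioning a random subset to contain `J`. -/
def likRatio {ι : Type} [DecidableEq ι] (q : ℝ) (J a : Finset ι) : ℝ :=
  if J ⊆ a then (q ^ J.card)⁻¹ else 0

theorem likRatio_nonneg {ι : Type} [DecidableEq ι] {q : ℝ} (hq : 0 ≤ q) (J a : Finset ι) :
    0 ≤ likRatio q J a := by
  unfold likRatio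
  split_ifs <;> positivity

theorem bernExp_likRatio_mul {ι : Type} [Fintype ι] [DecidableEq ι] {q : ℝ} (hq : q ≠ 0)
    (J : Finset ι) (f : Finset ι → ℝ) :
    bernExp q (fun a => likRatio q J a * f a) = bernExp q (fun a => f (a ∪ J)) := by
  have h : (fun a => likRatio q J a * f a) =
      fun a => (q ^ J.card)⁻¹ * (if J ⊆ a then f a else 0) := by
    funext a
    unfold likRatio
    split_ifs <;> simp
  rw [h, bernExp_const_mul, bernExp_subset, inv_mul_cancel_left₀ (pow_ne_zero _ hq)]

theorem bernExp_cov_le {ι : Type} [Fintype ι] [DecidableEq ι] {q : ℝ} (hq : 0 < q) (hq' : q ≤ 1)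
    {M : ℕ} (J K : Finset ι) (hJ : J.card ≤ M) :
    bernExp q (fun a => (1 - likRatio q J a) * (1 - likRatio q K a)) ≤
      if Disjoint J K then 0 else (q ^ M)⁻¹ := by
  have h1 (J : Finset ι) : bernExp q (fun a => likRatio q J a) = 1 := by
    simpa [bernExp_const] using bernExp_likRatio_mul hq.ne' J (fun _ => 1)
  have h2 : bernExp q (fun a => likRatio q J a * likRatio q K a) = (q ^ (J ∩ K).card)⁻¹ := by
    have h : (fun a => likRatio q J a * likRatio q K a) = fun a =>
        (q ^ (J ∩ K).card)⁻¹ * likRatio q (J ∪ K) a := by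
      funext a
      unfold likRatio
      have hc := Finset.card_union_add_card_inter J K
      by_cases hJ : J ⊆ a <;> by_cases hK : K ⊆ a <;>
        simp only [hJ, hK, Finset.union_subset_iff, and_true, and_self, and_false, if_true,
          if_false, mul_zero, zero_mul]
      rw [← mul_inv, ← mul_inv, ← pow_add, ← pow_add, ← hc, add_comm]
    rw [h, bernExp_const_mul, h1, mul_one]
  have h3 : (fun a => (1 - likRatio q J a) * (1 - likRatio q K a)) = fun a =>
      (1 - likRatio q J a) - (likRatio q K a - likRatio q J a * likRatio q K a) := by
    funext a; ring
  rw [h3, bernExp_sub, bernExp_sub, bernExp_sub, h1, h1, h2, bernExp_const]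
  split_ifs with hd
  · rw [Finset.disjoint_iff_inter_eq_empty.1 hd]; simp
  · have : (q ^ (J ∩ K).card)⁻¹ ≤ (q ^ M)⁻¹ := by
      apply inv_anti₀ (by positivity)
      exact pow_le_pow_of_le_one hq.le hq' ((Finset.card_le_card Finset.inter_subset_left).trans hJ)
    linarith

theorem bernExp_sq_sum_le {ι α : Type} [Fintype ι] [DecidableEq ι] {q : ℝ} (hq : 0 < q)
    (hq' : q ≤ 1) {M : ℕ} (D : Finset α) (J : α → Finset ι) (hJ : ∀ v ∈ D, (J v).card ≤ M) :
    bernExp q (fun a => (∑ v ∈ D, (1 - likRatio q (J v) a)) ^ 2) ≤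
      (q ^ M)⁻¹ * ∑ v ∈ D, ∑ w ∈ D, if Disjoint (J v) (J w) then 0 else 1 := by
  simp only [sq, Finset.sum_mul_sum, bernExp_sum]
  simp only [Finset.mul_sum]
  refine Finset.sum_le_sum fun v hv => Finset.sum_le_sum fun w hw => ?_
  refine (bernExp_cov_le hq hq' (J v) (J w) (hJ v hv)).trans ?_
  split_ifs <;> simp

theorem bernExp_card {ι : Type} [Fintype ι] [DecidableEq ι] (q : ℝ) :
    bernExp q (fun a : Finset ι => (a.card : ℝ)) = q * Fintype.card ι := by
  have h : (fun a : Finset ι => (a.card : ℝ)) = fun a => ∑ x, if x ∈ a then 1 else 0 := by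
    funext a; simp
  rw [h, bernExp_sum]
  simp [bernExp_insert q _ (fun _ => (1 : ℝ)), bernExp_const, mul_comm]

/-- The finite set of binary strings of length at most `L`. -/
def nodes (L : ℕ) : Finset (List Bool) := (List.finite_length_le Bool L).toFinset

/-- The finite set of binary strings of length `L`. -/
def leaves (L : ℕ) : Finset (List Bool) := (List.finite_length_eq Bool L).toFinset

@[simp] theorem mem_nodes {L : ℕ} {s : List Bool} : s ∈ nodes L ↔ s.length ≤ L := by
  simp [nodes]

@[simp] theorem mem_leaves {L : ℕ} {s : List Bool} : s ∈ leaves L ↔ s.length = L := by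
  simp [leaves]

theorem card_leaves (L : ℕ) : (leaves L).card = 2 ^ L := by
  have h : leaves L = Finset.univ.image (fun v : List.Vector Bool L => v.toList) := by
    ext s
    simp only [mem_leaves, Finset.mem_image, Finset.mem_univ, true_and]
    exact ⟨fun h => ⟨⟨s, h⟩, rfl⟩, fun ⟨v, hv⟩ => hv ▸ v.toList_length⟩
  rw [h, Finset.card_image_of_injective _ List.Vector.toList_injective, Finset.card_univ,
    card_vector, Fintype.card_bool]

theorem disjoint_map_cons {b b' : Bool} (hb : b ≠ b') (A B : Finset (List Bool)) :
    Disjoint (A.map ⟨List.cons b, List.cons_injective⟩)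
      (B.map ⟨List.cons b', List.cons_injective⟩) := by
  rw [Finset.disjoint_left]
  intro s h1 h2
  simp only [Finset.mem_map, Function.Embedding.coeFn_mk] at h1 h2
  obtain ⟨_, _, rfl⟩ := h1
  obtain ⟨_, _, h⟩ := h2
  exact hb (List.cons_eq_cons.1 h).1.symm

theorem sum_nodes_succ (L : ℕ) (f : List Bool → ℝ) :
    ∑ s ∈ nodes (L + 1), f s =
      f [] + (∑ s ∈ nodes L, f (true :: s) + ∑ s ∈ nodes L, f (false :: s)) := by
  have h : nodes (L + 1) = insert [] ((nodes L).map ⟨List.cons true, List.cons_injective⟩ ∪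
      (nodes L).map ⟨List.cons false, List.cons_injective⟩) := by
    ext s
    rcases s with _ | ⟨_ | _, s⟩ <;> simp
  rw [h, Finset.sum_insert (by simp), Finset.sum_union (disjoint_map_cons (by simp) _ _),
    Finset.sum_map, Finset.sum_map]
  rfl

theorem sum_nodes_prefix {L : ℕ} {v : List Bool} (hv : v.length = L) (f : List Bool → ℝ) :
    (∑ s ∈ nodes L, if s <+: v then f s else 0) = ∑ l ∈ Finset.range (L + 1), f (v.take l) := by
  rw [← Finset.sum_filter]
  symm
  refine Finset.sum_nbij (fun l => v.take l) ?_ ?_ ?_ fun _ _ => rfl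
  · intro l hl
    simp [List.take_prefix, hv]
  · intro l hl m hm h
    have := congrArg List.length h
    simp at hl hm this
    omega
  · intro s hs
    simp only [Finset.coe_filter, mem_nodes, Set.mem_ofPred_eq] at hs
    exact ⟨s.length, by simp; omega, (List.prefix_iff_eq_take.1 hs.2).symm⟩

theorem card_leaves_prefix_le {L : ℕ} {s : List Bool} (hs : s.length ≤ L) :
    ((leaves L).filter (fun v => s <+: v)).card ≤ 2 ^ (L - s.length) := by
  rw [← card_leaves]
  refine (Finset.card_le_card ?_).trans (Finset.card_image_le (f := fun t => s ++ t))
  intro v hv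
  simp only [Finset.mem_filter, mem_leaves] at hv
  obtain ⟨hl, t, rfl⟩ := hv
  simp at hl
  exact Finset.mem_image_of_mem _ (by simp; omega)

/-- Fractional covers of branches of a finite binary tree can be rounded to integral ones. -/
theorem exists_cover_of_fractional (L : ℕ) (ω c : List Bool → ℝ) (hω : ∀ s, 0 ≤ ω s)
    (hc : ∀ s, 0 ≤ c s) (θ : ℝ) (hθ : 0 < θ) :
    ∃ C : Finset (List Bool), θ * ∑ s ∈ C, ω s ≤ ∑ s ∈ nodes L, c s * ω s ∧
      ∀ v : List Bool, v.length = L → θ ≤ (∑ s ∈ nodes L, if s <+: v then c s else 0) →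
        ∃ s ∈ C, s <+: v := by
  induction L generalizing ω c θ with
  | zero =>
    have h0 : nodes 0 = {[]} := by ext s; simp
    by_cases h : θ ≤ c []
    · refine ⟨{[]}, ?_, fun v _ _ => ⟨[], by simp⟩⟩
      simpa [h0] using mul_le_mul_of_nonneg_right h (hω [])
    · refine ⟨∅, ?_, fun v _ hv => absurd ?_ h⟩
      · simpa [h0] using mul_nonneg (hc []) (hω [])
      · simpa [h0] using hv
  | succ L ih =>
    rw [sum_nodes_succ]
    have hnn (b : Bool) : 0 ≤ ∑ s ∈ nodes L, c (b :: s) * ω (b :: s) :=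
      Finset.sum_nonneg fun s _ => mul_nonneg (hc _) (hω _)
    by_cases h : θ ≤ c []
    · refine ⟨{[]}, ?_, fun v _ _ => ⟨[], by simp⟩⟩
      have := mul_le_mul_of_nonneg_right h (hω [])
      have h1 := hnn true
      have h2 := hnn false
      simp only [Finset.sum_singleton]
      linarith
    · have hθ' : 0 < θ - c [] := by linarith
      have ih' (b : Bool) := ih (fun s => ω (b :: s)) (fun s => c (b :: s)) (fun s => hω _)
        (fun s => hc _) (θ - c []) hθ'
      choose C hC1 hC2 using ih'
      set C' : Finset (List Bool) := (C true).map ⟨List.cons true, List.cons_injective⟩ ∪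
        (C false).map ⟨List.cons false, List.cons_injective⟩ with hC'
      have hsum : (θ - c []) * ∑ s ∈ C', ω s ≤ ∑ s ∈ nodes L, c (true :: s) * ω (true :: s) +
          ∑ s ∈ nodes L, c (false :: s) * ω (false :: s) := by
        refine le_trans ?_ (add_le_add (hC1 true) (hC1 false))
        rw [← mul_add, hC', Finset.sum_union (disjoint_map_cons (by simp) _ _), Finset.sum_map,
          Finset.sum_map]
        rfl
      by_cases hle : ∑ s ∈ C', ω s ≤ ω []
      · refine ⟨C', ?_, fun v hv hvθ => ?_⟩
        · have := mul_le_mul_of_nonneg_left hle (hc [])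
          linarith
        · rcases v with _ | ⟨b, v⟩
          · simp at hv
          · have hb := hC2 b v (by simpa using hv) (by
              rw [sum_nodes_succ] at hvθ
              cases b <;> simp [List.cons_prefix_cons] at hvθ <;> linarith)
            obtain ⟨s, hs, hsv⟩ := hb
            refine ⟨b :: s, ?_, by simpa [List.cons_prefix_cons] using hsv⟩
            rw [hC']
            cases b <;> simp [hs]
      · refine ⟨{[]}, ?_, fun v _ _ => ⟨[], by simp⟩⟩
        have := mul_le_mul_of_nonneg_left (not_le.1 hle).le hθ'.le
        simp only [Finset.sum_singleton]
        linarith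

theorem exists_sum_min_le (r : ℝ) (hr1 : r < 1) (ε : ℝ) (hε : 0 < ε) :
    ∃ u : ℝ, 0 < u ∧ ∀ n : ℕ,
      ∑ l ∈ Finset.range n, (2 : ℝ) ^ ((l : ℝ) * r) * min ((2 : ℝ) ^ l)⁻¹ u ≤ ε := by
  set ρ : ℝ := (2 : ℝ) ^ (r - 1) with hρ
  have hρ0 : 0 < ρ := by positivity
  have hρ1 : ρ < 1 := Real.rpow_lt_one_of_one_lt_of_neg (by norm_num) (by linarith)
  have hterm (l : ℕ) : (2 : ℝ) ^ ((l : ℝ) * r) * ((2 : ℝ) ^ l)⁻¹ = ρ ^ l := by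
    rw [hρ, ← Real.rpow_natCast, ← Real.rpow_natCast, ← Real.rpow_neg (by norm_num),
      ← Real.rpow_add (by norm_num), ← Real.rpow_mul (by norm_num)]
    congr 1; ring
  obtain ⟨m, hm⟩ : ∃ m : ℕ, ρ ^ m * (1 - ρ)⁻¹ ≤ ε / 2 := by
    have h := (tendsto_pow_atTop_nhds_zero_of_lt_one hρ0.le hρ1).mul_const (1 - ρ)⁻¹
    rw [zero_mul] at h
    obtain ⟨m, hm⟩ := (h.eventually (gt_mem_nhds (half_pos hε))).exists
    exact ⟨m, hm.le⟩
  set S : ℝ := ∑ l ∈ Finset.range m, (2 : ℝ) ^ ((l : ℝ) * r) with hS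
  have hS0 : 0 ≤ S := Finset.sum_nonneg fun _ _ => by positivity
  refine ⟨ε / 2 / (S + 1), by positivity, fun n => ?_⟩
  set u := ε / 2 / (S + 1) with hu
  have hu0 : 0 < u := by positivity
  calc _ ≤ ∑ l ∈ Finset.range (m + n), (2 : ℝ) ^ ((l : ℝ) * r) * min ((2 : ℝ) ^ l)⁻¹ u :=
        Finset.sum_le_sum_of_subset_of_nonneg (Finset.range_mono (by omega))
          fun _ _ _ => by positivity
    _ ≤ S * u + ∑ l ∈ Finset.range n, ρ ^ m * ρ ^ l := by
        rw [Finset.sum_range_add, hS, Finset.sum_mul]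
        refine add_le_add (Finset.sum_le_sum fun l _ => ?_) (Finset.sum_le_sum fun l _ => ?_)
        · exact mul_le_mul_of_nonneg_left (min_le_right _ _) (by positivity)
        · rw [← pow_add, ← hterm]
          exact mul_le_mul_of_nonneg_left (min_le_left _ _) (by positivity)
    _ ≤ ε / 2 + ε / 2 := by
        refine add_le_add ?_ ?_
        · rw [hu, mul_div_assoc', div_le_iff₀ (by positivity)]
          nlinarith
        · rw [← Finset.mul_sum]
          refine le_trans (mul_le_mul_of_nonneg_left ?_ (by positivity)) hm
          rw [← tsum_geometric_of_lt_one hρ0.le hρ1]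
          exact (summable_geometric_of_lt_one hρ0.le hρ1).sum_le_tsum _ fun _ _ => by positivity
    _ = ε := by ring

/-- The real number `2 ^ (-|s| r)`. -/
def nodeWeight (r : ℝ) (s : List Bool) : ℝ := (2 : ℝ) ^ (-(s.length : ℝ) * r)

theorem nodeWeight_pos (r : ℝ) (s : List Bool) : 0 < nodeWeight r s := by
  unfold nodeWeight; positivity

theorem sum_overlap_le {ι : Type} [DecidableEq ι] (r : ℝ) {L M : ℕ} {u : ℝ}
    {D : Finset (List Bool)} (hD : D ⊆ leaves L) (J : List Bool → Finset ι)
    (hJ : ∀ v ∈ D, (J v).card ≤ M)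
    (hlight : ∀ v ∈ D, ∀ x ∈ J v,
      (M + 1) * ((D.filter (fun w => x ∈ J w)).card : ℝ) ≤ u * 2 ^ L) (hu : 0 ≤ u) :
    ∑ s ∈ nodes L, (nodeWeight r s)⁻¹ * (∑ v ∈ D with s <+: v, ∑ w ∈ D with s <+: w,
      if Disjoint (J v) (J w) then (0 : ℝ) else 1) ≤
    2 ^ L * 2 ^ L * ∑ l ∈ Finset.range (L + 1),
      (2 : ℝ) ^ ((l : ℝ) * r) * min ((2 : ℝ) ^ l)⁻¹ u := by
  set d : List Bool → List Bool → ℝ := fun v w => if Disjoint (J v) (J w) then 0 else 1 with hd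
  have hd0 (v w) : 0 ≤ d v w := by simp only [hd]; split_ifs <;> norm_num
  have hd1 (v w) : d v w ≤ 1 := by simp only [hd]; split_ifs <;> norm_num
  have hcD : (D.card : ℝ) ≤ 2 ^ L := by
    exact_mod_cast (Finset.card_le_card hD).trans (card_leaves L).le
  have hinner1 : ∀ v ∈ D, ∀ l ∈ Finset.range (L + 1),
      ∑ w ∈ D with v.take l <+: w, d v w ≤ 2 ^ L * ((2 : ℝ) ^ l)⁻¹ := by
    intro v hv l hl
    have hvl : (v.take l).length = l := by
      have := mem_leaves.1 (hD hv)
      simp at hl ⊢; omega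
    have hlL : l ≤ L := by simp at hl; omega
    calc _ ≤ ∑ w ∈ D with v.take l <+: w, (1 : ℝ) := Finset.sum_le_sum fun w _ => hd1 v w
      _ = ((D.filter (fun w => v.take l <+: w)).card : ℝ) := by simp
      _ ≤ (2 : ℝ) ^ (L - l) := by
        have := (Finset.card_le_card (Finset.filter_subset_filter (fun w => v.take l <+: w) hD)).trans
          (card_leaves_prefix_le (s := v.take l) (by omega))
        rw [hvl] at this
        exact_mod_cast this
      _ = _ := by rw [pow_sub₀ _ (by norm_num) hlL]
  have hinner2 : ∀ v ∈ D, ∀ s : List Bool, ∑ w ∈ D with s <+: w, d v w ≤ 2 ^ L * u := by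
    intro v hv s
    calc _ ≤ ∑ w ∈ D, d v w :=
          Finset.sum_le_sum_of_subset_of_nonneg (Finset.filter_subset _ _) fun w _ _ => hd0 v w
      _ ≤ ∑ w ∈ D, ∑ x ∈ J v, if x ∈ J w then (1 : ℝ) else 0 := by
        refine Finset.sum_le_sum fun w _ => ?_
        have hnn : ∀ x ∈ J v, (0 : ℝ) ≤ if x ∈ J w then (1 : ℝ) else 0 := fun x _ => by
          split_ifs <;> norm_num
        simp only [hd]
        split_ifs with h
        · exact Finset.sum_nonneg hnn
        · obtain ⟨x, hx, hx'⟩ := Finset.not_disjoint_iff.1 h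
          have := Finset.single_le_sum hnn hx
          simpa [hx'] using this
      _ = ∑ x ∈ J v, ((D.filter (fun w => x ∈ J w)).card : ℝ) := by
        rw [Finset.sum_comm]; simp
      _ ≤ ∑ x ∈ J v, u * 2 ^ L / (M + 1) := by
        refine Finset.sum_le_sum fun x hx => ?_
        rw [le_div_iff₀' (by positivity)]
        exact hlight v hv x hx
      _ = (J v).card * (u * 2 ^ L / (M + 1)) := by simp
      _ ≤ (M + 1) * (u * 2 ^ L / (M + 1)) := by
        have : ((J v).card : ℝ) ≤ M := by exact_mod_cast hJ v hv
        gcongr; linarith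
      _ = 2 ^ L * u := by field_simp
  calc _ = ∑ v ∈ D, ∑ s ∈ nodes L,
        if s <+: v then (nodeWeight r s)⁻¹ * ∑ w ∈ D with s <+: w, d v w else 0 := by
        rw [Finset.sum_comm]
        refine Finset.sum_congr rfl fun s _ => ?_
        rw [Finset.mul_sum, Finset.sum_filter]
    _ = ∑ v ∈ D, ∑ l ∈ Finset.range (L + 1),
        (nodeWeight r (v.take l))⁻¹ * ∑ w ∈ D with v.take l <+: w, d v w :=
      Finset.sum_congr rfl fun v hv => sum_nodes_prefix (mem_leaves.1 (hD hv))
        (fun s => (nodeWeight r s)⁻¹ * ∑ w ∈ D with s <+: w, d v w)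
    _ ≤ ∑ v ∈ D, ∑ l ∈ Finset.range (L + 1),
        2 ^ L * ((2 : ℝ) ^ ((l : ℝ) * r) * min ((2 : ℝ) ^ l)⁻¹ u) := by
      refine Finset.sum_le_sum fun v hv => Finset.sum_le_sum fun l hl => ?_
      have hvl : (v.take l).length = l := by
        have := mem_leaves.1 (hD hv)
        simp at hl ⊢; omega
      rw [nodeWeight, hvl, ← Real.rpow_neg (by norm_num), neg_mul, neg_neg, mul_left_comm]
      refine mul_le_mul_of_nonneg_left ?_ (by positivity)
      rw [mul_min_of_nonneg _ _ (by positivity)]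
      exact le_min (hinner1 v hv l hl) (hinner2 v hv _)
    _ ≤ _ := by
      rw [Finset.sum_const, nsmul_eq_mul, ← Finset.mul_sum, mul_assoc]
      refine mul_le_mul_of_nonneg_right hcD ?_
      exact mul_nonneg (by positivity) (Finset.sum_nonneg fun l _ => by positivity)

theorem discrepancy_le (r : ℝ) {L : ℕ} (G D : Finset (List Bool)) (hG : G ⊆ nodes L)
    (γ : ℝ) (hGγ : ∑ s ∈ G, nodeWeight r s ≤ γ / 2) (y : List Bool → ℝ) (κ : ℝ) (hκ : 0 < κ) :
    ∑ v ∈ D, y v * (1 - ∑ s ∈ G, if s <+: v then (1 : ℝ) else 0) ≤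
      κ * (1 + γ / 2) / 2 +
        ∑ s ∈ nodes L, (κ * nodeWeight r s)⁻¹ * (∑ v ∈ D with s <+: v, y v) ^ 2 := by
  set Y : List Bool → ℝ := fun s => ∑ v ∈ D with s <+: v, y v with hY
  have young (t x : ℝ) (ht : 0 < t) : |x| ≤ t / 2 + t⁻¹ * x ^ 2 / 2 := by
    have h : t * |x| ≤ t * (t / 2 + t⁻¹ * x ^ 2 / 2) := by
      rw [mul_add, ← sq_abs x]
      field_simp
      nlinarith [sq_nonneg (t - |x|)]
    exact le_of_mul_le_mul_left h ht
  have hpos (s) : 0 < κ * nodeWeight r s := mul_pos hκ (nodeWeight_pos r s)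
  have hq (s) : 0 ≤ (κ * nodeWeight r s)⁻¹ * Y s ^ 2 :=
    mul_nonneg (inv_pos.2 (hpos s)).le (sq_nonneg _)
  have h0 : nodeWeight r [] = 1 := by simp [nodeWeight]
  have hroot : Y [] ≤ κ / 2 + (∑ s ∈ nodes L, (κ * nodeWeight r s)⁻¹ * Y s ^ 2) / 2 := by
    refine (le_abs_self _).trans ((young _ _ (hpos [])).trans ?_)
    have := Finset.single_le_sum (f := fun s => (κ * nodeWeight r s)⁻¹ * Y s ^ 2)
      (fun s _ => hq s) (show [] ∈ nodes L by simp)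
    simp only [h0, mul_one] at this ⊢
    linarith
  have hsum : -∑ s ∈ G, Y s ≤
      κ * (γ / 2) / 2 + (∑ s ∈ nodes L, (κ * nodeWeight r s)⁻¹ * Y s ^ 2) / 2 := by
    rw [← Finset.sum_neg_distrib]
    calc _ ≤ ∑ s ∈ G, (κ * nodeWeight r s / 2 + (κ * nodeWeight r s)⁻¹ * Y s ^ 2 / 2) :=
          Finset.sum_le_sum fun s _ => (neg_le_abs _).trans (young _ _ (hpos s))
      _ ≤ _ := by
        rw [Finset.sum_add_distrib, ← Finset.sum_div, ← Finset.sum_div, ← Finset.mul_sum]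
        have := Finset.sum_le_sum_of_subset_of_nonneg hG
          (f := fun s => (κ * nodeWeight r s)⁻¹ * Y s ^ 2) fun s _ _ => hq s
        have := mul_le_mul_of_nonneg_left hGγ hκ.le
        linarith
  have heq : ∑ v ∈ D, y v * (1 - ∑ s ∈ G, if s <+: v then (1 : ℝ) else 0) =
      Y [] - ∑ s ∈ G, Y s := by
    simp only [mul_sub, mul_one, Finset.sum_sub_distrib, Finset.mul_sum, hY]
    congr 1
    · simp
    · rw [Finset.sum_comm]
      refine Finset.sum_congr rfl fun s _ => ?_
      rw [Finset.sum_filter]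
      exact Finset.sum_congr rfl fun v _ => by split_ifs <;> simp
  rw [heq]
  linarith

/-- Every set of at most `M` points extends to a set `H'` such that a random set conditioned to
contain `H'` belongs to `𝒴` with probability at least `p`. -/
def Robust {ι : Type} [Fintype ι] [DecidableEq ι] (q : ℝ) (M : ℕ) (p : ℝ)
    (𝒴 : Set (Finset ι)) : Prop :=
  ∀ H : Finset ι, H.card ≤ M → ∃ H', H ⊆ H' ∧
    p ≤ bernExp q (fun a => 𝒴.indicator (fun _ => (1 : ℝ)) (a ∪ H'))

theorem bernExp_sum_mul_le {ι : Type} [Fintype ι] [DecidableEq ι] (r : ℝ) {q : ℝ} (hq : 0 < q)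
    (hq' : q ≤ 1) {L M : ℕ} {u κ γ : ℝ} (hu : 0 ≤ u) (hκ : 0 < κ) (hγ : 0 < γ)
    {D : Finset (List Bool)} (hD : D ⊆ leaves L) (J : List Bool → Finset ι)
    (hJ : ∀ v ∈ D, (J v).card ≤ M)
    (hlight : ∀ v ∈ D, ∀ x ∈ J v,
      (M + 1) * ((D.filter (fun w => x ∈ J w)).card : ℝ) ≤ u * 2 ^ L)
    (𝒴 : Set (Finset ι)) (G : Finset ι → Finset (List Bool)) (H : Finset ι)
    (hGL : ∀ b ∈ 𝒴, G b ⊆ nodes L) (hGγ : ∀ b ∈ 𝒴, ∑ s ∈ G b, nodeWeight r s ≤ γ / 2) :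
    bernExp q (fun a => ∑ v ∈ D, (1 - likRatio q (J v) a) *
      𝒴.indicator (fun b => 1 - ∑ s ∈ G b, if s <+: v then (1 : ℝ) else 0) (a ∪ H)) ≤
    2 ^ L * (κ * (1 + γ / 2) / 2 + κ⁻¹ * (q ^ M)⁻¹ * ∑ l ∈ Finset.range (L + 1),
      (2 : ℝ) ^ ((l : ℝ) * r) * min ((2 : ℝ) ^ l)⁻¹ u) := by
  have hκL : 0 < κ * 2 ^ L := by positivity
  set Y : List Bool → Finset ι → ℝ :=
    fun s a => ∑ v ∈ D with s <+: v, (1 - likRatio q (J v) a) with hY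
  have hpt (a : Finset ι) : ∑ v ∈ D, (1 - likRatio q (J v) a) *
      𝒴.indicator (fun b => 1 - ∑ s ∈ G b, if s <+: v then (1 : ℝ) else 0) (a ∪ H) ≤
      κ * 2 ^ L * (1 + γ / 2) / 2 +
        ∑ s ∈ nodes L, (κ * 2 ^ L * nodeWeight r s)⁻¹ * Y s a ^ 2 := by
    by_cases hb : a ∪ H ∈ 𝒴
    · simp only [Set.indicator_of_mem hb]
      exact discrepancy_le r (G (a ∪ H)) D (hGL _ hb) γ (hGγ _ hb) _ _ hκL
    · simp only [Set.indicator_of_notMem hb, mul_zero, Finset.sum_const_zero]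
      have : 0 ≤ ∑ s ∈ nodes L, (κ * 2 ^ L * nodeWeight r s)⁻¹ * Y s a ^ 2 :=
        Finset.sum_nonneg fun s _ => mul_nonneg
          (inv_pos.2 (mul_pos hκL (nodeWeight_pos r s))).le (sq_nonneg _)
      positivity
  refine (bernExp_mono hq.le hq' hpt).trans ?_
  rw [bernExp_add, bernExp_const, bernExp_sum]
  have hvar : ∑ s ∈ nodes L, bernExp q (fun a => (κ * 2 ^ L * nodeWeight r s)⁻¹ * Y s a ^ 2) ≤
      (κ * 2 ^ L)⁻¹ * (q ^ M)⁻¹ * ∑ s ∈ nodes L, (nodeWeight r s)⁻¹ *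
        (∑ v ∈ D with s <+: v, ∑ w ∈ D with s <+: w,
          if Disjoint (J v) (J w) then (0 : ℝ) else 1) := by
    rw [Finset.mul_sum]
    refine Finset.sum_le_sum fun s _ => ?_
    rw [bernExp_const_mul]
    have h := bernExp_sq_sum_le hq hq' (D.filter (fun v => s <+: v)) J
      (M := M) fun v hv => hJ v (Finset.mem_filter.1 hv).1
    refine (mul_le_mul_of_nonneg_left h (inv_pos.2 (mul_pos hκL (nodeWeight_pos r s))).le).trans ?_
    rw [mul_inv _ (nodeWeight r s)]
    exact le_of_eq (by ring)
  have hov := mul_le_mul_of_nonneg_left (sum_overlap_le r hD J hJ hlight hu)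
    (show 0 ≤ (κ * 2 ^ L)⁻¹ * (q ^ M)⁻¹ by positivity)
  refine (add_le_add_right (hvar.trans hov) _).trans (le_of_eq ?_)
  generalize ∑ l ∈ Finset.range (L + 1), (2 : ℝ) ^ ((l : ℝ) * r) * min ((2 : ℝ) ^ l)⁻¹ u = S
  field_simp

theorem mem_cover_or_mul_card_le {ι : Type} [Fintype ι] [DecidableEq ι] (r : ℝ) {q : ℝ}
    (hq : 0 < q) (hq' : q ≤ 1) {L M : ℕ} {u κ γ p : ℝ} (hu : 0 ≤ u) (hκ : 0 < κ) (hγ : 0 < γ)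
    (hp : 0 < p) {B : Finset (List Bool)} (hB : B ⊆ leaves L) (J : List Bool → Finset ι)
    (hJ : ∀ v ∈ B, (J v).card ≤ M)
    (hlight : ∀ v ∈ B, ∀ x ∈ J v,
      (M + 1) * ((B.filter (fun w => x ∈ J w)).card : ℝ) ≤ u * 2 ^ L)
    (𝒴 : Set (Finset ι)) (G : Finset ι → Finset (List Bool)) (H : Finset ι)
    (hGL : ∀ b ∈ 𝒴, G b ⊆ nodes L) (hGγ : ∀ b ∈ 𝒴, ∑ s ∈ G b, nodeWeight r s ≤ γ / 2)
    (hH : p ≤ bernExp q (fun a => 𝒴.indicator (fun _ => (1 : ℝ)) (a ∪ H)))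
    (hbad : ∀ v ∈ B, bernExp q (fun a => {b ∈ 𝒴 | ∀ s ∈ G b, ¬ s <+: v}.indicator
      (fun _ => (1 : ℝ)) (a ∪ (H ∪ J v))) < p / 8) :
    ∃ C : Finset (List Bool), ∑ s ∈ C, nodeWeight r s < γ ∧
      p / 8 * ((B.filter (fun v => ∀ s ∈ C, ¬ s <+: v)).card : ℝ) ≤
        2 ^ L * (κ * (1 + γ / 2) / 2 + κ⁻¹ * (q ^ M)⁻¹ * ∑ l ∈ Finset.range (L + 1),
          (2 : ℝ) ^ ((l : ℝ) * r) * min ((2 : ℝ) ^ l)⁻¹ u) := by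
  set P : ℝ := bernExp q (fun a => 𝒴.indicator (fun _ => (1 : ℝ)) (a ∪ H)) with hP
  have hP0 : 0 < P := hp.trans_le hH
  set c : List Bool → ℝ := fun s => bernExp q (fun a =>
    𝒴.indicator (fun b => if s ∈ G b then (1 : ℝ) else 0) (a ∪ H)) with hc
  have hc0 (s) : 0 ≤ c s := by
    have h0 : bernExp q (fun _ : Finset ι => (0 : ℝ)) = 0 := bernExp_const q 0
    rw [← h0]
    refine bernExp_mono hq.le hq' fun a => Set.indicator_nonneg (fun b _ => ?_) _
    split_ifs <;> norm_num
  have hsum (f : List Bool → ℝ) : ∑ s ∈ nodes L, c s * f s =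
      bernExp q (fun a => 𝒴.indicator (fun b => ∑ s ∈ G b, f s) (a ∪ H)) := by
    have h (s) : c s * f s = bernExp q (fun a => f s *
        𝒴.indicator (fun b => if s ∈ G b then (1 : ℝ) else 0) (a ∪ H)) := by
      rw [bernExp_const_mul, mul_comm]
    simp only [h]
    rw [← bernExp_sum]
    congr 1
    funext a
    by_cases hb : a ∪ H ∈ 𝒴
    · simp only [Set.indicator_of_mem hb, mul_ite, mul_one, mul_zero]
      rw [← Finset.sum_filter, Finset.filter_mem_eq_inter, Finset.inter_eq_right.2 (hGL _ hb)]
    · simp [Set.indicator_of_notMem hb]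
  have htot : ∑ s ∈ nodes L, c s * nodeWeight r s ≤ P * (γ / 2) := by
    rw [hsum, hP, mul_comm, ← bernExp_const_mul]
    refine bernExp_mono hq.le hq' fun a => ?_
    by_cases hb : a ∪ H ∈ 𝒴
    · simpa [Set.indicator_of_mem hb] using hGγ _ hb
    · simp [Set.indicator_of_notMem hb]
  obtain ⟨C, hC1, hC2⟩ := exists_cover_of_fractional L (nodeWeight r) c
    (fun s => (nodeWeight_pos r s).le) hc0 (3 / 4 * P) (by positivity)
  refine ⟨C, ?_, ?_⟩
  · have h := hC1.trans htot
    by_contra hcon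
    have := mul_le_mul_of_nonneg_left (not_lt.1 hcon) (show 0 ≤ 3 / 4 * P by positivity)
    nlinarith [mul_pos hP0 hγ]
  set D := B.filter (fun v => ∀ s ∈ C, ¬ s <+: v) with hD
  have hDB : D ⊆ B := Finset.filter_subset _ _
  refine le_trans ?_ (bernExp_sum_mul_le r hq hq' hu hκ hγ (hDB.trans hB) J
    (fun v hv => hJ v (hDB hv)) (fun v hv x hx => ?_) 𝒴 G H hGL hGγ)
  · rw [bernExp_sum, mul_comm, ← nsmul_eq_mul]
    refine Finset.card_nsmul_le_sum _ _ _ fun v hv => ?_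
    have hvB := hDB hv
    have hvL := mem_leaves.1 (hB hvB)
    set g : Finset ι → ℝ :=
      𝒴.indicator (fun b => 1 - ∑ s ∈ G b, if s <+: v then (1 : ℝ) else 0) with hg
    have h1 : (fun a => (1 - likRatio q (J v) a) * g (a ∪ H)) =
        fun a => g (a ∪ H) - likRatio q (J v) a * g (a ∪ H) := by funext a; ring
    rw [h1, bernExp_sub, bernExp_likRatio_mul hq.ne']
    have h2 : bernExp q (fun a => g (a ∪ J v ∪ H)) < p / 8 := by
      refine lt_of_le_of_lt (bernExp_mono hq.le hq' fun a => ?_) (hbad v hvB)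
      rw [show a ∪ J v ∪ H = a ∪ (H ∪ J v) by
        rw [Finset.union_assoc, Finset.union_comm (J v)]]
      set b := a ∪ (H ∪ J v)
      by_cases hb : b ∈ 𝒴
      · by_cases hcov : ∀ s ∈ G b, ¬ s <+: v
        · rw [hg, Set.indicator_of_mem hb, Set.indicator_of_mem (by exact ⟨hb, hcov⟩)]
          have : 0 ≤ ∑ s ∈ G b, if s <+: v then (1 : ℝ) else 0 :=
            Finset.sum_nonneg fun s _ => by split_ifs <;> norm_num
          linarith
        · rw [hg, Set.indicator_of_mem hb, Set.indicator_of_notMem (fun h => hcov h.2)]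
          push Not at hcov
          obtain ⟨s, hs, hsv⟩ := hcov
          have := Finset.single_le_sum (f := fun s => if s <+: v then (1 : ℝ) else 0)
            (fun s _ => by split_ifs <;> norm_num) hs
          simp only [hsv, if_true] at this
          linarith
      · rw [hg, Set.indicator_of_notMem hb, Set.indicator_of_notMem (fun h => hb h.1)]
    have h3 : bernExp q (fun a => g (a ∪ H)) =
        P - ∑ s ∈ nodes L, c s * if s <+: v then 1 else 0 := by
      rw [hsum, hP, ← bernExp_sub]
      congr 1
      funext a
      by_cases hb : a ∪ H ∈ 𝒴
      · simp only [hg, Set.indicator_of_mem hb]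
      · simp [hg, Set.indicator_of_notMem hb]
    have h4 : ∑ s ∈ nodes L, c s * (if s <+: v then 1 else 0) < 3 / 4 * P := by
      by_contra hcon
      obtain ⟨s, hs, hsv⟩ := hC2 v hvL (by simpa using not_lt.1 hcon)
      exact (Finset.mem_filter.1 hv).2 s hs hsv
    rw [h3]
    linarith
  · refine le_trans ?_ (hlight v (hDB hv) x hx)
    have := Finset.card_le_card (Finset.filter_subset_filter (fun w => x ∈ J w) hDB)
    gcongr

open Classical in
theorem Robust.exists_cover {r : ℝ} (hr1 : r < 1) {q γ δ p : ℝ} (hq : 0 < q) (hq' : q ≤ 1)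
    (hγ : 0 < γ) (hδ : 0 < δ) (hp : 0 < p) (M : ℕ) :
    ∃ K : ℕ, ∀ {ι : Type} [Fintype ι] [DecidableEq ι] (𝒴 : Set (Finset ι))
      (G : Finset ι → Finset (List Bool)) (L : ℕ), Robust q K p 𝒴 →
      (∀ b ∈ 𝒴, G b ⊆ nodes L) → (∀ b ∈ 𝒴, ∑ s ∈ G b, nodeWeight r s ≤ γ / 2) →
      ∃ C : Finset (List Bool), ∑ s ∈ C, nodeWeight r s < γ ∧
        (((leaves L).filter (fun v => ¬ Robust q M (p / 8) {b ∈ 𝒴 | ∀ s ∈ G b, ¬ s <+: v} ∧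
          ∀ s ∈ C, ¬ s <+: v)).card : ℝ) < δ * 2 ^ L := by
  set κ : ℝ := δ * p / (16 * (1 + γ / 2)) with hκ
  have hκ0 : 0 < κ := by positivity
  obtain ⟨u, hu, hsmall⟩ := exists_sum_min_le r hr1 (δ * p * κ * q ^ M / 32) (by positivity)
  obtain ⟨K, hK⟩ := exists_nat_ge ((M : ℝ) * (M + 1) / u)
  refine ⟨K, fun {ι} _ _ 𝒴 G L hrob hGL hGγ => ?_⟩
  set B := (leaves L).filter (fun v => ¬ Robust q M (p / 8) {b ∈ 𝒴 | ∀ s ∈ G b, ¬ s <+: v})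
    with hB
  have hBL : B ⊆ leaves L := Finset.filter_subset _ _
  have hex (v : List Bool) : ∃ J : Finset ι, v ∈ B → J.card ≤ M ∧ ∀ H', J ⊆ H' →
      bernExp q (fun a => {b ∈ 𝒴 | ∀ s ∈ G b, ¬ s <+: v}.indicator
        (fun _ => (1 : ℝ)) (a ∪ H')) < p / 8 := by
    by_cases hv : v ∈ B
    · have := (Finset.mem_filter.1 hv).2
      unfold Robust at this
      push Not at this
      obtain ⟨J, hJ, h⟩ := this
      exact ⟨J, fun _ => ⟨hJ, h⟩⟩
    · exact ⟨∅, fun h => absurd h hv⟩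
  choose T hT using hex
  set Hv : Finset ι := Finset.univ.filter
    (fun x => u * 2 ^ L < (M + 1) * ((B.filter (fun w => x ∈ T w)).card : ℝ)) with hHv
  have hHcard : Hv.card ≤ K := by
    have hBc : (B.card : ℝ) ≤ 2 ^ L := by
      exact_mod_cast (Finset.card_le_card hBL).trans (card_leaves L).le
    have h1 : (Hv.card : ℝ) * (u * 2 ^ L) ≤ (M + 1) * (2 ^ L * M) := by
      calc (Hv.card : ℝ) * (u * 2 ^ L) = ∑ x ∈ Hv, u * 2 ^ L := by simp
        _ ≤ ∑ x ∈ Hv, (M + 1) * ((B.filter (fun w => x ∈ T w)).card : ℝ) :=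
          Finset.sum_le_sum fun x hx => (Finset.mem_filter.1 hx).2.le
        _ ≤ ∑ x, (M + 1) * ((B.filter (fun w => x ∈ T w)).card : ℝ) :=
          Finset.sum_le_sum_of_subset_of_nonneg (Finset.subset_univ _) fun _ _ _ => by positivity
        _ = (M + 1) * ∑ w ∈ B, ((T w).card : ℝ) := by
          rw [← Finset.mul_sum]
          congr 1
          have (x : ι) : ((B.filter (fun w => x ∈ T w)).card : ℝ) =
            ∑ w ∈ B, if x ∈ T w then 1 else 0 := by simp
          simp only [this]
          rw [Finset.sum_comm]
          simp
        _ ≤ (M + 1) * ∑ w ∈ B, (M : ℝ) := by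
          gcongr with w hw
          exact (hT w hw).1
        _ ≤ (M + 1) * (2 ^ L * M) := by
          rw [Finset.sum_const, nsmul_eq_mul]
          gcongr
    have h2 : (Hv.card : ℝ) ≤ M * (M + 1) / u := by
      rw [le_div_iff₀ hu]
      have h2L : (0 : ℝ) < 2 ^ L := by positivity
      nlinarith
    exact_mod_cast h2.trans hK
  obtain ⟨H, hHsub, hHp⟩ := hrob Hv hHcard
  have hlight : ∀ v ∈ B, ∀ x ∈ T v \ H,
      (M + 1) * ((B.filter (fun w => x ∈ T w \ H)).card : ℝ) ≤ u * 2 ^ L := by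
    intro v hv x hx
    have hxv : x ∉ Hv := fun h => (Finset.mem_sdiff.1 hx).2 (hHsub h)
    rw [hHv, Finset.mem_filter] at hxv
    simp only [Finset.mem_univ, true_and, not_lt] at hxv
    refine le_trans ?_ hxv
    gcongr with w
    exact Finset.sdiff_subset
  obtain ⟨C, hCγ, hC⟩ := mem_cover_or_mul_card_le r hq hq' hu.le hκ0 hγ hp hBL
    (fun v => T v \ H) (fun v hv => (Finset.card_le_card Finset.sdiff_subset).trans (hT v hv).1)
    hlight 𝒴 G H hGL hGγ hHp (fun v hv => (hT v hv).2 _ (by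
      rw [Finset.union_sdiff_self_eq_union]
      exact Finset.subset_union_right))
  refine ⟨C, hCγ, ?_⟩
  rw [← Finset.filter_filter]
  have h2L : (0 : ℝ) < 2 ^ L := by positivity
  have h3 : κ * (1 + γ / 2) / 2 = δ * p / 32 := by rw [hκ]; field_simp; norm_num
  have h4 : κ⁻¹ * (q ^ M)⁻¹ * (δ * p * κ * q ^ M / 32) = δ * p / 32 := by field_simp
  have h5 := mul_le_mul_of_nonneg_left (hsmall (L + 1))
    (show 0 ≤ κ⁻¹ * (q ^ M)⁻¹ by positivity)
  rw [h4] at h5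
  rw [h3] at hC
  have h6 := hC.trans (mul_le_mul_of_nonneg_left (add_le_add_right h5 _) h2L.le)
  by_contra hcon
  have := mul_le_mul_of_nonneg_left (not_lt.1 hcon) (show 0 ≤ p / 8 by positivity)
  nlinarith [mul_pos (mul_pos hδ hp) h2L]

/-- The initial segment of `z` of length `L`. -/
def initSeg (L : ℕ) (z : Cantor) : List Bool := List.ofFn fun i : Fin L => z i

@[simp] theorem length_initSeg (L : ℕ) (z : Cantor) : (initSeg L z).length = L := by
  simp [initSeg]

theorem mem_cyl_iff_prefix {L : ℕ} {s : List Bool} (hs : s.length ≤ L) (z : Cantor) :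
    z ∈ cyl s ↔ s <+: initSeg L z := by
  rw [List.prefix_iff_eq_take, List.ext_get_iff]
  simp only [cyl, Set.mem_ofPred_eq, List.length_take, length_initSeg, min_eq_left hs, true_and]
  constructor
  · intro h i hi hi'
    simpa [initSeg] using (h ⟨i, hi⟩).symm
  · intro h i
    simpa [initSeg] using (h i i.2 (by simpa using hs)).symm

theorem mem_cyl_of_prefix {L : ℕ} {s : List Bool} {z : Cantor} (h : s <+: initSeg L z) :
    z ∈ cyl s :=
  (mem_cyl_iff_prefix (by simpa using h.length_le) z).2 h

theorem mem_cyl_initSeg (L : ℕ) (z : Cantor) : z ∈ cyl (initSeg L z) :=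
  mem_cyl_of_prefix (List.prefix_refl _)

theorem measurableSet_cyl (s : List Bool) : MeasurableSet (cyl s) := by
  have h : cyl s = ⋂ i : Fin s.length, (fun x : Cantor => x i) ⁻¹' {s.get i} := by
    ext x; simp [cyl]
  rw [h]
  exact MeasurableSet.iInter fun i => measurable_pi_apply _ (measurableSet_singleton _)

theorem floor_eq_of_digits_eq {x y : ℝ} (hx : x ∈ Set.Ico (0 : ℝ) 1) (hy : y ∈ Set.Ico (0 : ℝ) 1)
    (n : ℕ) (h : ∀ i < n, (⌊x * 2 ^ (i + 1)⌋ % 2 = 1 ↔ ⌊y * 2 ^ (i + 1)⌋ % 2 = 1)) :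
    ⌊x * 2 ^ n⌋ = ⌊y * 2 ^ n⌋ := by
  induction n with
  | zero =>
    rw [pow_zero, mul_one, mul_one, Int.floor_eq_zero_iff.2 hx, Int.floor_eq_zero_iff.2 hy]
  | succ n ih =>
    have hdiv (t : ℝ) : ⌊t * 2 ^ (n + 1)⌋ / 2 = ⌊t * 2 ^ n⌋ := by
      have := Int.floor_div_natCast (t * 2 ^ (n + 1)) 2
      push_cast at this
      rw [← this]
      congr 1
      ring
    have h1 := ih fun i hi => h i (by omega)
    have h2 := h n (by omega)
    rw [← hdiv x, ← hdiv y] at h1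
    omega

theorem cantorMeasure_cyl_le (s : List Bool) :
    cantorMeasure (cyl s) ≤ ENNReal.ofReal ((2 : ℝ) ^ s.length)⁻¹ := by
  have hm : Measurable (fun x : ℝ => fun n : ℕ => decide (⌊x * 2 ^ (n + 1)⌋ % 2 = 1)) := by
    refine measurable_pi_lambda _ fun n => ?_
    have h1 : Measurable fun k : ℤ => decide (k % 2 = 1) := measurable_from_top
    exact h1.comp (Int.measurable_floor.comp (measurable_id.mul_const _))
  rw [cantorMeasure, Measure.map_apply hm (measurableSet_cyl s),
    Measure.restrict_apply (hm (measurableSet_cyl s))]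
  set S := (fun x : ℝ => fun n : ℕ => decide (⌊x * 2 ^ (n + 1)⌋ % 2 = 1)) ⁻¹' cyl s ∩
    Set.Ico (0 : ℝ) 1 with hS
  rcases S.eq_empty_or_nonempty with he | ⟨y, hy⟩
  · simp [he]
  have h2 : (0 : ℝ) < 2 ^ s.length := by positivity
  have hsub : S ⊆ Set.Ico ((⌊y * 2 ^ s.length⌋ : ℝ) / 2 ^ s.length)
      ((⌊y * 2 ^ s.length⌋ + 1 : ℝ) / 2 ^ s.length) := by
    intro x hx
    have hfl := floor_eq_of_digits_eq hx.2 hy.2 s.length fun i hi => by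
      have h3 := hx.1 ⟨i, hi⟩
      have h4 := hy.1 ⟨i, hi⟩
      rw [← h4] at h3
      simpa using h3
    rw [← hfl, Set.mem_Ico, div_le_iff₀ h2, lt_div_iff₀ h2]
    exact ⟨Int.floor_le _, Int.lt_floor_add_one _⟩
  refine (measure_mono hsub).trans (le_of_eq ?_)
  rw [Real.volume_Ico]
  congr 1
  field_simp
  ring

theorem wtSum_coe (r : ℝ) (C : Finset (List Bool)) :
    wtSum r (C : Set (List Bool)) = ENNReal.ofReal (∑ s ∈ C, nodeWeight r s) := by
  rw [wtSum, Finset.tsum_subtype' C (wt r),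
    ENNReal.ofReal_sum_of_nonneg fun s _ => (nodeWeight_pos r s).le]
  refine Finset.sum_congr rfl fun s _ => ?_
  rw [wt, nodeWeight, ← ENNReal.ofReal_rpow_of_pos (by norm_num)]
  norm_num

theorem sqcap_lt_of_cover {r γ δ : ℝ} (hγ : 0 < γ) {X : Set Cantor} {L : ℕ}
    {C D : Finset (List Bool)} (hD : D ⊆ leaves L) (hC : ∑ s ∈ C, nodeWeight r s < γ)
    (hDδ : (D.card : ℝ) < δ * 2 ^ L)
    (h : ∀ z ∈ X, initSeg L z ∈ D ∨ ∃ s ∈ C, s <+: initSeg L z) :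
    sqcap r δ X < ENNReal.ofReal γ := by
  have h2 : (0 : ℝ) < 2 ^ L := by positivity
  have hZm : MeasurableSet (⋃ v ∈ D, cyl v) :=
    Finset.measurableSet_biUnion D fun v _ => measurableSet_cyl v
  have hδ : 0 < δ := pos_of_mul_pos_left ((Nat.cast_nonneg _).trans_lt hDδ) h2.le
  have hZ : cantorMeasure (⋃ v ∈ D, cyl v) < ENNReal.ofReal δ := by
    calc _ ≤ ∑ v ∈ D, cantorMeasure (cyl v) := measure_biUnion_finset_le _ _
      _ ≤ ∑ v ∈ D, ENNReal.ofReal ((2 : ℝ) ^ L)⁻¹ := Finset.sum_le_sum fun v hv => by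
        have := cantorMeasure_cyl_le v
        rwa [mem_leaves.1 (hD hv)] at this
      _ = ENNReal.ofReal (D.card * ((2 : ℝ) ^ L)⁻¹) := by
        rw [Finset.sum_const, nsmul_eq_mul, ENNReal.ofReal_mul (Nat.cast_nonneg _),
          ENNReal.ofReal_natCast]
      _ < _ := by
        rw [ENNReal.ofReal_lt_ofReal_iff hδ, ← div_eq_mul_inv, div_lt_iff₀ h2]
        exact hDδ
  have hcov : X \ (⋃ v ∈ D, cyl v) ⊆ cylSet C := by
    rintro z ⟨hz, hzD⟩
    rcases h z hz with hv | ⟨s, hs, hsz⟩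
    · exact absurd (Set.mem_biUnion hv (mem_cyl_initSeg L z)) hzD
    · exact Set.mem_biUnion (Finset.mem_coe.2 hs) (mem_cyl_of_prefix hsz)
  calc sqcap r δ X ≤ hcap r (X \ ⋃ v ∈ D, cyl v) :=
        iInf_le_of_le _ (iInf_le_of_le hZm (iInf_le _ hZ))
    _ ≤ wtSum r (C : Set (List Bool)) := iInf_le_of_le _ (iInf_le _ hcov)
    _ < ENNReal.ofReal γ := by
        rw [wtSum_coe, ENNReal.ofReal_lt_ofReal_iff hγ]
        exact hC

theorem sqcap_mono (r δ : ℝ) {X Y : Set Cantor} (h : X ⊆ Y) : sqcap r δ X ≤ sqcap r δ Y :=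
  iInf_mono fun _ => iInf_mono fun _ => iInf_mono fun _ => le_iInf fun _ => le_iInf fun hA =>
    iInf_le_of_le _ (iInf_le _ ((Set.sdiff_subset_sdiff_left h).trans hA))

/-- The set of binary strings of length `n` coded by a finite set of functions. -/
def strings (n : ℕ) (b : Finset (Fin n → Bool)) : Set (List Bool) := List.ofFn '' (b : Set (Fin n → Bool))

theorem exists_sqcap_not_robust_lt {r : ℝ} (hr1 : r < 1) {q γ δ p : ℝ} (hq : 0 < q)
    (hq' : q ≤ 1) (hγ : 0 < γ) (hδ : 0 < δ) (hp : 0 < p) (M : ℕ) :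
    ∃ K : ℕ, ∀ (n : ℕ) (𝒳 : Set (Set (List Bool))) (F : Set (List Bool) → Set (List Bool)),
      Robust q K p {b | strings n b ∈ 𝒳} →
      (∀ a ∈ 𝒳, (F a).Finite ∧ memCinf r (γ / 2) (F a)) →
      sqcap r δ {z | ¬ Robust q M (p / 8) {b | strings n b ∈ angbr z F 𝒳}} <
        ENNReal.ofReal γ := by
  classical
  obtain ⟨K, hK⟩ := Robust.exists_cover (δ := δ) hr1 hq hq' hγ hδ hp M
  refine ⟨K, fun n 𝒳 F hrob hF => ?_⟩
  set G : Finset (Fin n → Bool) → Finset (List Bool) := fun b =>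
    if h : strings n b ∈ 𝒳 then (hF _ h).1.toFinset else ∅ with hG
  have hGF (b) (hb : strings n b ∈ 𝒳) : (G b : Set (List Bool)) = F (strings n b) := by
    simp [hG, hb]
  set L : ℕ := Finset.univ.sup fun b => (G b).sup List.length with hL
  have hGL (b) : G b ⊆ nodes L := fun s hs => mem_nodes.2 <|
    (Finset.le_sup (f := List.length) hs).trans
      (Finset.le_sup (f := fun b => (G b).sup List.length) (Finset.mem_univ b))
  obtain ⟨C, hC, hD⟩ := hK {b | strings n b ∈ 𝒳} G L hrob (fun b _ => hGL b) fun b hb => by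
    have h := (hF _ hb).2
    rw [memCinf, ← hGF b hb, wtSum_coe] at h
    exact (ENNReal.ofReal_le_ofReal_iff (by positivity)).1 h
  refine sqcap_lt_of_cover hγ (Finset.filter_subset _ _) hC hD fun z hz => ?_
  by_cases hcov : ∃ s ∈ C, s <+: initSeg L z
  · exact Or.inr hcov
  · refine Or.inl (Finset.mem_filter.2 ⟨by simp, ?_, fun s hs hsz => hcov ⟨s, hs, hsz⟩⟩)
    convert hz using 3
    ext b
    simp only [Set.mem_ofPred_eq, angbr]
    refine and_congr_right fun hb => ?_
    rw [← hGF b hb, cylSet]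
    simp only [Set.mem_iUnion, Finset.mem_coe, not_exists]
    exact forall₂_congr fun s hs => not_congr
      (mem_cyl_iff_prefix (mem_nodes.1 (hGL b hs)) z).symm

theorem cylSet_sUnion_eq_univ {q p : ℝ} (hp : 0 < p) {n : ℕ} {𝒳 : Set (Set (List Bool))}
    (h : Robust q 1 p {b | strings n b ∈ 𝒳}) : cylSet (⋃₀ 𝒳) = Set.univ := by
  refine Set.eq_univ_of_forall fun z => ?_
  obtain ⟨H, hH, hpH⟩ := h {fun i : Fin n => z i} (by simp)
  obtain ⟨a, ha⟩ : ∃ a, strings n (a ∪ H) ∈ 𝒳 := by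
    by_contra! hcon
    have h0 : (fun a => {b | strings n b ∈ 𝒳}.indicator (fun _ => (1 : ℝ)) (a ∪ H)) =
        fun _ => 0 := funext fun a => Set.indicator_of_notMem (show a ∪ H ∉ {b | strings n b ∈ 𝒳} from hcon a) _
    rw [h0, bernExp_const] at hpH
    linarith
  refine Set.mem_biUnion (Set.mem_sUnion.2 ⟨_, ha, ?_⟩) (mem_cyl_initSeg n z)
  exact ⟨_, Finset.mem_coe.2 (Finset.mem_union_right _ (hH (Finset.mem_singleton_self _))), rfl⟩

theorem exists_mem_Nrec_of_robust {r : ℝ} (hr1 : r < 1) {Θ Γ : ℕ → ℝ} (hΘpos : ∀ i, 0 < Θ i)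
    (hΓpos : ∀ i, 0 < Γ i) {q : ℝ} (hq : 0 < q) (hq' : q ≤ 1) (k : ℕ) :
    ∀ p : ℝ, 0 < p → ∃ K : ℕ, ∀ (n : ℕ) (𝒳 : Set (Set (List Bool))),
      Robust q K p {b | strings n b ∈ 𝒳} → 𝒳 ∈ Nrec r Θ Γ (k + 1) := by
  induction k with
  | zero => exact fun p hp => ⟨1, fun n 𝒳 h => cylSet_sUnion_eq_univ hp h⟩
  | succ k ih =>
    intro p hp
    obtain ⟨M, hM⟩ := ih (p / 8) (by positivity)
    obtain ⟨K, hK⟩ :=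
      exists_sqcap_not_robust_lt hr1 hq hq' (hΓpos (k + 1)) (hΘpos k) hp M
    exact ⟨K, fun n 𝒳 h F hF => (sqcap_mono r _ fun z (hz : _ ∉ _) =>
      show ¬ Robust q M (p / 8) {b | strings n b ∈ angbr z F 𝒳} from
        fun hrob => hz (hM n _ hrob)).trans_lt (hK n 𝒳 F h hF)⟩

theorem robust_card_le {ι : Type} [Fintype ι] [DecidableEq ι] {q t : ℝ} (hq : 0 ≤ q)
    (hq' : q ≤ 1) {K : ℕ} (ht : 0 < t) (h : q * Fintype.card ι + K ≤ t / 2) :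
    Robust q K (1 / 2) {b : Finset ι | (b.card : ℝ) ≤ t} := by
  refine fun H hH => ⟨H, subset_rfl, ?_⟩
  have hpt (a : Finset ι) : 1 - t⁻¹ * (a.card + K) ≤
      {b : Finset ι | (b.card : ℝ) ≤ t}.indicator (fun _ => (1 : ℝ)) (a ∪ H) := by
    by_cases hb : ((a ∪ H).card : ℝ) ≤ t
    · rw [Set.indicator_of_mem (by exact hb)]
      have : 0 ≤ t⁻¹ * (a.card + K) := by positivity
      linarith
    · rw [Set.indicator_of_notMem (by exact hb)]
      have h1 : ((a ∪ H).card : ℝ) ≤ a.card + K := by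
        exact_mod_cast (Finset.card_union_le _ _).trans (by omega)
      have h2 := mul_le_mul_of_nonneg_left ((not_le.1 hb).le.trans h1) (inv_pos.2 ht).le
      rw [inv_mul_cancel₀ ht.ne'] at h2
      linarith
  refine le_trans ?_ (bernExp_mono hq hq' hpt)
  rw [bernExp_sub, bernExp_const_mul, bernExp_add, bernExp_const, bernExp_const, bernExp_card]
  have := mul_le_mul_of_nonneg_left h (inv_pos.2 ht).le
  have h3 : t⁻¹ * (t / 2) = 1 / 2 := by field_simp
  linarith

theorem strings_injective (n : ℕ) : Function.Injective (strings n) :=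
  (Set.image_injective.2 List.ofFn_injective).comp Finset.coe_injective

theorem memCinf_strings {n : ℕ} {μ₀ : ℝ} {b : Finset (Fin n → Bool)}
    (hb : (b.card : ℝ) ≤ μ₀ * 2 ^ n) : memCinf 1 μ₀ (strings n b) := by
  have h : strings n b = (b.image List.ofFn : Finset (List Bool)) := by simp [strings]
  rw [memCinf, h, wtSum_coe]
  refine ENNReal.ofReal_le_ofReal ?_
  rw [Finset.sum_image List.ofFn_injective.injOn]
  have hw (x : Fin n → Bool) : nodeWeight 1 (List.ofFn x) = ((2 : ℝ) ^ n)⁻¹ := by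
    rw [nodeWeight, List.length_ofFn, mul_one, Real.rpow_neg (by norm_num), Real.rpow_natCast]
  simp only [hw, Finset.sum_const, nsmul_eq_mul]
  rwa [← div_eq_mul_inv, div_le_iff₀ (by positivity)]

theorem statement17 (r : ℝ) (hr0 : 0 < r) (hr1 : r < 1)
    (Θ Γ : ℕ → ℝ) (hΘpos : ∀ i, 0 < Θ i) (hΓpos : ∀ i, 0 < Γ i)
    (hΘanti : StrictAnti Θ) (hΘlim : Filter.Tendsto Θ Filter.atTop (nhds 0))
    (hΘΓ : ∀ j, Θ j + Γ j < 1) (hΘΓsucc : ∀ j, Θ j + Γ (j + 1) < 1)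
    (hΓdense : ∀ x ∈ Set.Ioo (0 : ℝ) 1, x ∈ closure (Set.range Γ))
    (j : ℕ) (μ₀ : ℝ) (hμ : 0 < μ₀) :
    ∃ 𝒳 : Set (Set (List Bool)), 𝒳.Finite ∧
      (∀ a ∈ 𝒳, a.Finite ∧ memCinf 1 μ₀ a) ∧ (j : ℕ∞) ≤ nu r Θ Γ 𝒳 := by
  obtain ⟨q, hq, hq', hqμ⟩ : ∃ q : ℝ, 0 < q ∧ q ≤ 1 ∧ q ≤ μ₀ / 4 :=
    ⟨min 1 (μ₀ / 4), by positivity, min_le_left _ _, min_le_right _ _⟩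
  obtain ⟨K, hK⟩ := exists_mem_Nrec_of_robust hr1 hΘpos hΓpos hq hq' j (1 / 2) (by norm_num)
  obtain ⟨n, hn⟩ := pow_unbounded_of_one_lt (4 * K / μ₀) (show (1 : ℝ) < 2 by norm_num)
  rw [div_lt_iff₀ hμ] at hn
  set 𝒳 := strings n '' {b | (b.card : ℝ) ≤ μ₀ * 2 ^ n} with h𝒳
  refine ⟨𝒳, (Set.toFinite _).image _, ?_, ?_⟩
  · rintro _ ⟨b, hb, rfl⟩
    exact ⟨b.finite_toSet.image _, memCinf_strings hb⟩
  · have hmem : 𝒳 ∈ Nrec r Θ Γ (j + 1) := by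
      refine hK n 𝒳 ?_
      have h1 : {b | strings n b ∈ 𝒳} = {b | (b.card : ℝ) ≤ μ₀ * 2 ^ n} :=
        (strings_injective n).preimage_image _
      rw [h1]
      refine robust_card_le hq.le hq' (by positivity) ?_
      have h2 := mul_le_mul_of_nonneg_right hqμ (show (0 : ℝ) ≤ 2 ^ n by positivity)
      simp only [Fintype.card_fun, Fintype.card_bool, Fintype.card_fin, Nat.cast_pow,
        Nat.cast_ofNat]
      linarith
    refine le_trans ?_ (le_sSup ⟨j + 1, hmem, rfl⟩)
    exact Nat.cast_le.2 (Nat.le_succ j)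
end
end

section
/- For (a,b) ∈ [0,1]² let L_{a,b} ⊆ ℝ² be the straight line through the points (a,0) and (1,b). If X ⊆ [0,1]² has 1-dimensional Hausdorff measure zero, then the set (⋃_{(a,b)∈X} L_{a,b}) ∩ [0,1]² has 2-dimensional Lebesgue (outer) measure zero. -/
open MeasureTheory Set
open scoped ENNReal

/-- The straight line through the points `(a,0)` and `(1,b)` (for `(a,0) ≠ (1,b)` this is the
unique line of `ℝ²` containing both points). -/
def lineThrough (a b : ℝ) : Set (ℝ × ℝ) :=
  {p : ℝ × ℝ | ∃ t : ℝ, p = (a, 0) + t • ((1, b) - (a, 0))}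

open Metric NNReal in
/-- A Lipschitz image of `U × [0, 1]` in the plane has area at most of the order of any
`δ ≤ 1` bounding the diameter of `U`. -/
theorem LipschitzOnWith.volume_image_prod_Icc_le_mul {E : Type*} [PseudoEMetricSpace E]
    {F : E × ℝ → ℝ × ℝ} {K : ℝ≥0} {U : Set E}
    (hF : LipschitzOnWith K F (U ×ˢ Icc (0 : ℝ) 1)) {δ : ℝ≥0} (hδ : 0 < δ) (hδ1 : δ ≤ 1)
    (hU : ediam U ≤ δ) :
    volume (F '' (U ×ˢ Icc (0 : ℝ) 1)) ≤ ((8 * K ^ 2 * δ : ℝ≥0) : ℝ≥0∞) := by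
  obtain rfl | ⟨u, hu⟩ := U.eq_empty_or_nonempty
  · simp
  have hδ' : (0 : ℝ) < δ := hδ
  set N : ℕ := ⌊1 / δ⌋₊ + 1 with hN
  have hcover : F '' (U ×ˢ Icc (0 : ℝ) 1) ⊆
      ⋃ j ∈ Finset.range N, closedEBall (F (u, j * δ)) (K * δ) := by
    rintro _ ⟨⟨v, s⟩, ⟨hv, hs0, hs1⟩, rfl⟩
    simp only at hv hs0 hs1
    set j := ⌊s / δ⌋₊
    have hle : (j : ℝ) * δ ≤ s :=
      (le_div_iff₀ hδ').1 (Nat.floor_le (div_nonneg hs0 hδ'.le))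
    have hlt : s < (j + 1) * δ := (div_lt_iff₀ hδ').1 (Nat.lt_floor_add_one _)
    have hj : j < N := by
      refine Nat.lt_succ_of_le (Nat.le_floor ?_)
      rw [le_div_iff₀ hδ]
      exact_mod_cast hle.trans hs1
    simp only [mem_iUnion, Finset.mem_range]
    refine ⟨j, hj, ?_⟩
    refine (hF (x := (v, s)) ⟨hv, hs0, hs1⟩ (y := (u, j * δ))
      ⟨hu, by positivity, hle.trans hs1⟩).trans ?_
    gcongr
    refine max_le ((edist_le_ediam_of_mem hv hu).trans hU) ?_
    rw [edist_dist, Real.dist_eq, abs_of_nonneg (by linarith : 0 ≤ s - j * δ)]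
    exact ENNReal.ofReal_le_of_le_toReal (by simp; linarith)
  have hball (x : ℝ × ℝ) :
      volume (closedEBall x (K * δ)) = ((4 * K ^ 2 * δ ^ 2 : ℝ≥0) : ℝ≥0∞) := by
    rw [← closedEBall_prod_same, Measure.volume_eq_prod, Measure.prod_prod,
      Real.volume_closedEBall, Real.volume_closedEBall]
    push_cast
    ring
  have hNδ : (N : ℝ≥0) * δ ≤ 2 := by
    have h : (⌊1 / δ⌋₊ : ℝ≥0) * δ ≤ 1 := (le_div_iff₀ hδ).1 (Nat.floor_le zero_le)
    calc (N : ℝ≥0) * δ = ⌊1 / δ⌋₊ * δ + δ := by rw [hN]; push_cast; ring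
      _ ≤ 1 + 1 := by gcongr
      _ = 2 := by norm_num
  calc volume (F '' (U ×ˢ Icc (0 : ℝ) 1))
      ≤ ∑ j ∈ Finset.range N, volume (closedEBall (F (u, j * δ)) (K * δ)) :=
        (measure_mono hcover).trans (measure_biUnion_finset_le _ _)
    _ = ((N * (4 * K ^ 2 * δ ^ 2) : ℝ≥0) : ℝ≥0∞) := by
        simp_rw [hball]
        simp
    _ ≤ _ := by
        norm_cast
        calc (N : ℝ≥0) * (4 * K ^ 2 * δ ^ 2) = N * δ * (4 * K ^ 2 * δ) := by ring
          _ ≤ 2 * (4 * K ^ 2 * δ) := by gcongr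
          _ = 8 * K ^ 2 * δ := by ring

open Metric NNReal Filter Topology in
theorem LipschitzOnWith.volume_image_prod_Icc_le_mul_ediam {E : Type*} [PseudoEMetricSpace E]
    {F : E × ℝ → ℝ × ℝ} {K : ℝ≥0} {U : Set E}
    (hF : LipschitzOnWith K F (U ×ˢ Icc (0 : ℝ) 1)) (hU : ediam U < 1) :
    volume (F '' (U ×ˢ Icc (0 : ℝ) 1)) ≤ ((8 * K ^ 2 : ℝ≥0) : ℝ≥0∞) * ediam U := by
  obtain ⟨d, hd⟩ : ∃ d : ℝ≥0, (d : ℝ≥0∞) = ediam U := ⟨_, ENNReal.coe_toNNReal hU.ne_top⟩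
  rw [← hd] at hU ⊢
  have hd1 : d < 1 := by exact_mod_cast hU
  rw [← ENNReal.coe_mul]
  have hlim : Tendsto (fun δ : ℝ≥0 ↦ ((8 * K ^ 2 * δ : ℝ≥0) : ℝ≥0∞)) (𝓝[>] d)
      (𝓝 ((8 * K ^ 2 * d : ℝ≥0) : ℝ≥0∞)) :=
    ((ENNReal.continuous_coe.comp (continuous_const.mul continuous_id)).tendsto d).mono_left
      nhdsWithin_le_nhds
  refine ge_of_tendsto hlim ?_
  filter_upwards [Ioo_mem_nhdsGT hd1] with δ hδ
  refine hF.volume_image_prod_Icc_le_mul (zero_le.trans_lt hδ.1) hδ.2.le ?_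
  rw [← hd]
  exact_mod_cast hδ.1.le

open Metric NNReal in
theorem LipschitzOnWith.volume_image_prod_Icc_eq_zero {E : Type*} [EMetricSpace E]
    [MeasurableSpace E] [BorelSpace E] {F : E × ℝ → ℝ × ℝ} {K : ℝ≥0} {X : Set E}
    (hF : LipschitzOnWith K F (X ×ˢ Icc (0 : ℝ) 1)) (hX : μH[1] X = 0) :
    volume (F '' (X ×ˢ Icc (0 : ℝ) 1)) = 0 := by
  set μ : OuterMeasure E := OuterMeasure.map Prod.fst
    (OuterMeasure.restrict (X ×ˢ Icc (0 : ℝ) 1)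
      (OuterMeasure.comap F (volume : Measure (ℝ × ℝ)).toOuterMeasure))
  have hμ (U : Set E) : μ U = volume (F '' ((U ∩ X) ×ˢ Icc (0 : ℝ) 1)) := by
    simp only [μ, OuterMeasure.map_apply, OuterMeasure.restrict_apply, OuterMeasure.comap_apply,
      Measure.coe_toOuterMeasure]
    congr 2
    ext ⟨x, s⟩
    simp [and_assoc]
  have hc : 8 * K ^ 2 + 1 ≠ 0 := by positivity
  have hle : μ ≤ (8 * K ^ 2 + 1) • OuterMeasure.mkMetric fun r : ℝ≥0∞ ↦ r ^ (1 : ℝ) := by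
    rw [← OuterMeasure.mkMetric_nnreal_smul _ hc]
    refine OuterMeasure.le_mkMetric _ _ 2⁻¹ (by simp) fun U hU ↦ ?_
    have hUX : ediam (U ∩ X) ≤ ediam U := ediam_mono inter_subset_left
    rw [hμ]
    refine ((hF.mono (prod_mono_left inter_subset_right)).volume_image_prod_Icc_le_mul_ediam
      (hUX.trans_lt (hU.trans_lt (by simp)))).trans ?_
    simp only [Pi.smul_apply, ENNReal.rpow_one, ENNReal.smul_def, smul_eq_mul]
    gcongr
    simp
  have h := hle X
  rw [hμ, inter_self, smul_apply, OuterMeasure.coe_mkMetric] at h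
  change _ ≤ _ • μH[1] X at h
  simpa [hX] using h

/-- The affine parametrisation of the lines `lineThrough a b`, with parameter shifted by `m`. -/
def lineParam (m : ℝ) (q : (ℝ × ℝ) × ℝ) : ℝ × ℝ :=
  (q.1.1, 0) + (m + q.2) • ((1, q.1.2) - (q.1.1, 0))

theorem contDiff_lineParam (m : ℝ) : ContDiff ℝ 1 (lineParam m) := by
  unfold lineParam
  fun_prop

theorem exists_lipschitzOnWith_lineParam (m : ℝ) :
    ∃ K, LipschitzOnWith K (lineParam m)
      ((Icc (0 : ℝ) 1 ×ˢ Icc (0 : ℝ) 1) ×ˢ Icc (0 : ℝ) 1) := by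
  have hcpt : IsCompact ((Icc (0 : ℝ) 1 ×ˢ Icc (0 : ℝ) 1) ×ˢ Icc (0 : ℝ) 1) :=
    (isCompact_Icc.prod isCompact_Icc).prod isCompact_Icc
  exact LocallyLipschitzOn.exists_lipschitzOnWith_of_compact hcpt
    (contDiff_lineParam m).locallyLipschitz.locallyLipschitzOn

theorem statement18 (X : Set (ℝ × ℝ))
    (hX : X ⊆ Set.Icc (0 : ℝ) 1 ×ˢ Set.Icc (0 : ℝ) 1)
    (hH : μH[1] X = 0) :
    volume ((⋃ p ∈ X, lineThrough p.1 p.2) ∩ Set.Icc (0 : ℝ) 1 ×ˢ Set.Icc (0 : ℝ) 1) = 0 := by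
  have hnull : volume (⋃ m : ℤ, lineParam m '' (X ×ˢ Icc (0 : ℝ) 1)) = 0 := by
    refine measure_iUnion_null fun m ↦ ?_
    obtain ⟨K, hK⟩ := exists_lipschitzOnWith_lineParam m
    exact (hK.mono (prod_mono_left hX)).volume_image_prod_Icc_eq_zero hH
  refine measure_mono_null (inter_subset_left.trans ?_) hnull
  refine iUnion₂_subset fun p hp ↦ ?_
  rintro _ ⟨t, rfl⟩
  refine mem_iUnion.2 ⟨⌊t⌋, (p, Int.fract t),
    ⟨hp, Int.fract_nonneg t, (Int.fract_lt_one t).le⟩, ?_⟩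
  simp [lineParam]
end
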